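/- Let p be a prime and H a p-uniform hypergraph with at least one edge. Set t = Xind_{Z_p}(Hom(K^p_p, H)) + p. Then the local chromatic number of H satisfies χ_l(H) ≥ min( ⌈t/p⌉ + 1, ⌈t/(p−1)⌉ ). -/

import Mathlib

/-- The sets `U i` span a complete `p`-uniform `p`-partite subhypergraph. -/
def SpansComplete {W : Type*} [DecidableEq W] (Eh : Set (Finset W)) (r : ℕ) {p : ℕ}
    (U : ZMod p → Finset W) : Prop :=
  ∀ T : Finset W, T.card = r → (∀ v ∈ T, ∃ i, v ∈ U i) →
    (∀ i, (T ∩ U i).card ≤ 1) → T ∈ Eh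

/-- Elements of the `Z_p`-hom-complex `Hom(K^r_p, H)`. -/
def HomElem {W : Type*} [DecidableEq W] (Eh : Set (Finset W)) (r p : ℕ)
    (U : ZMod p → Finset W) : Prop :=
  (∀ i, (U i).Nonempty) ∧ (∀ i j, i ≠ j → Disjoint (U i) (U j)) ∧
    SpansComplete Eh r U

/-- The cross-index `Xind_{Z_p}(Hom(K^r_p, H))`. -/
noncomputable def XindHom {W : Type*} [DecidableEq W] (Eh : Set (Finset W)) (r p : ℕ) : ℕ :=
  sInf {n | ∃ φ : (ZMod p → Finset W) → ZMod p × Fin (n + 1),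
    (∀ x y, HomElem Eh r p x → HomElem Eh r p y → (∀ i, x i ⊆ y i) →
      ((φ x).2 < (φ y).2 ∨ φ x = φ y)) ∧
    (∀ (ε : ZMod p) (x), HomElem Eh r p x →
      φ (fun i => x (i + ε)) = (ε + (φ x).1, (φ x).2))}

/-- The closed neighborhood `N[X] = X ∪ N(X)` of a vertex set `X` in a hypergraph. -/
def closedNbr {W : Type*} [DecidableEq W] (Eh : Set (Finset W)) (X : Finset W) : Set W :=
  ↑X ∪ {v | ∃ e ∈ Eh, e \ X = {v}}

theorem aux_periodic {p : ℕ} [Fact p.Prime] {X : Type*} (r : ZMod p → X) (d : ZMod p)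
    (hd : d ≠ 0) (h : ∀ i, r (i + d) = r i) (i : ZMod p) : r i = r 0 := by
  have key : ∀ k : ℕ, r ((k : ZMod p) * d) = r 0 := by
    intro k
    induction k with
    | zero => simp
    | succ k ih => rw [← ih, ← h ((k : ZMod p) * d)]; congr 1; push_cast; ring
  have := key (i / d).val
  rw [ZMod.natCast_zmod_val, div_mul_cancel₀ _ hd] at this
  exact this

theorem aux_sign (p : ℕ) [Fact p.Prime] (X : Type*) :
    ∃ σ : (ZMod p → X) → ZMod p, ∀ f : ZMod p → X, (∃ i j, f i ≠ f j) →
      ∀ ε, σ (fun i => f (i + ε)) = ε + σ f := by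
  classical
  let S : Setoid (ZMod p → X) :=
    { r := fun f g => ∃ δ, g = fun i => f (i + δ)
      iseqv := 
        { refl := fun f => ⟨0, by simp⟩
          symm := by
            rintro f g ⟨δ, rfl⟩
            exact ⟨-δ, by simp⟩
          trans := by
            rintro f g h ⟨δ, rfl⟩ ⟨δ', rfl⟩
            exact ⟨δ' + δ, by funext i; simp [add_assoc]⟩ } }
  have h : ∀ f : ZMod p → X, ∃ δ, f = fun i => (Quotient.out (Quotient.mk S f)) (i + δ) := by
    intro f
    exact Quotient.mk_out (s := S) f
  choose σ hσ using h
  refine ⟨σ, ?_⟩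
  rintro f ⟨a, b, hab⟩ ε
  have hq : Quotient.mk S (fun i => f (i + ε)) = Quotient.mk S f :=
    (Quotient.sound (s := S) ⟨ε, rfl⟩ : Quotient.mk S f = Quotient.mk S (fun i => f (i + ε))).symm
  have h1 := hσ (fun i => f (i + ε))
  rw [hq] at h1
  have h2 := hσ f
  generalize Quotient.out (Quotient.mk S f) = r at h1 h2
  by_contra hne
  have hper := aux_periodic r (σ (fun i => f (i + ε)) - (ε + σ f)) (sub_ne_zero.2 hne) (by
    intro i
    have e1 := congrFun h1 (i - (ε + σ f))
    have e2 := congrFun h2 (i - (ε + σ f) + ε)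
    rw [e2] at e1
    rw [show i - (ε + σ f) + ε + σ f = i by ring] at e1
    rw [e1]; congr 1; ring)
  apply hab
  have e1 := congrFun h2 a
  have e2 := congrFun h2 b
  rw [e1, e2, hper, hper (b + _)]

theorem aux_transversal {W : Type*} [DecidableEq W] {Eh : Set (Finset W)} {p : ℕ} [NeZero p]
    {U : ZMod p → Finset W} (hU : HomElem Eh p p U) (f : ZMod p → W) (hf : ∀ i, f i ∈ U i) :
    Finset.univ.image f ∈ Eh ∧ Function.Injective f := by
  obtain ⟨h1, h2, h3⟩ := hU
  have key : ∀ i j, f i ∈ U j → i = j := by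
    intro i j hij
    by_contra hne
    exact Finset.disjoint_left.1 (h2 i j hne) (hf i) hij
  have inj : Function.Injective f := by
    intro i j hij
    exact key i j (hij ▸ hf j)
  refine ⟨h3 _ ?_ ?_ ?_, inj⟩
  · rw [Finset.card_image_of_injective _ inj, Finset.card_univ, ZMod.card]
  · intro v hv
    obtain ⟨i, -, rfl⟩ := Finset.mem_image.1 hv
    exact ⟨i, hf i⟩
  · intro i
    apply Finset.card_le_one.2
    intro a ha b hb
    simp only [Finset.mem_inter, Finset.mem_image, Finset.mem_univ, true_and] at ha hb
    obtain ⟨⟨a, rfl⟩, ha⟩ := ha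
    obtain ⟨⟨b, rfl⟩, hb⟩ := hb
    rw [key _ _ ha, key _ _ hb]

theorem aux_edge {W : Type*} [DecidableEq W] {Eh : Set (Finset W)} {p : ℕ} [NeZero p]
    {e : Finset W} (he : e ∈ Eh) (hcard : e.card = p) :
    ∃ U : ZMod p → Finset W, HomElem Eh p p U := by
  have hc : Fintype.card (ZMod p) = Fintype.card e := by simp [ZMod.card, hcard]
  let F := Fintype.equivOfCardEq hc
  refine ⟨fun i => {(F i : W)}, fun i => by simp, ?_, ?_⟩
  · intro i j hij
    simp only [Finset.disjoint_singleton]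
    intro h
    exact hij (F.injective (Subtype.ext h))
  · intro T hT hTU _
    have : T = e := by
      apply Finset.eq_of_subset_of_card_le
      · intro v hv
        obtain ⟨i, hi⟩ := hTU v hv
        rw [Finset.mem_singleton.1 hi]
        exact (F i).2
      · omega
    rwa [this]

theorem aux_no_common {W : Type*} [DecidableEq W] {p : ℕ} [NeZero p]
    {Eh : Set (Finset W)} {Ct : Type*} [DecidableEq Ct] {c : W → Ct}
    (hc : ∀ e ∈ Eh, ∃ u ∈ e, ∃ v ∈ e, c u ≠ c v)
    {U : ZMod p → Finset W} (hU : HomElem Eh p p U) (a : Ct) :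
    ∃ i, a ∉ (U i).image c := by
  by_contra! h
  simp only [Finset.mem_image] at h
  choose f hf hfa using h
  obtain ⟨he, -⟩ := aux_transversal hU f hf
  obtain ⟨u, hu, v, hv, huv⟩ := hc _ he
  obtain ⟨i, -, rfl⟩ := Finset.mem_image.1 hu
  obtain ⟨j, -, rfl⟩ := Finset.mem_image.1 hv
  exact huv ((hfa i).trans (hfa j).symm)

theorem aux_exists {W : Type*} [DecidableEq W] {p : ℕ} [Fact p.Prime]
    {Eh : Set (Finset W)} (hEh : Eh.Nonempty) (hunif : ∀ e ∈ Eh, e.card = p)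
    {Ct : Type*} [DecidableEq Ct] {c : W → Ct}
    (hc : ∀ e ∈ Eh, ∃ u ∈ e, ∃ v ∈ e, c u ≠ c v) :
    ∃ U : ZMod p → Finset W, HomElem Eh p p U ∧
      XindHom Eh p p + p ≤ ∑ i, ((U i).image c).card := by
  have low : ∀ U : ZMod p → Finset W, HomElem Eh p p U → p ≤ ∑ i, ((U i).image c).card := by
    intro U hU
    calc p = ∑ i : ZMod p, 1 := by simp [ZMod.card]
      _ ≤ _ := Finset.sum_le_sum fun i _ => Finset.card_pos.2 ((hU.1 i).image c)
  by_contra! hcon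
  obtain ⟨e, he⟩ := hEh
  obtain ⟨U0, hU0⟩ := aux_edge (p := p) he (hunif e he)
  have hpos : 0 < XindHom Eh p p := by
    have := low U0 hU0; have := hcon U0 hU0; omega
  obtain ⟨σ, hσ⟩ := aux_sign p (Finset Ct)
  have hlt : XindHom Eh p p - 1 < XindHom Eh p p := by omega
  refine Nat.notMem_of_lt_sInf hlt ?_
  refine ⟨fun U => (σ (fun i => (U i).image c),
    ⟨min (∑ i, ((U i).image c).card - p) (XindHom Eh p p - 1), by omega⟩), ?_, ?_⟩
  · intro x y hx hy hxy
    have hsub : ∀ i, (x i).image c ⊆ (y i).image c := fun i => Finset.image_subset_image (hxy i)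
    have hle : ∀ i ∈ Finset.univ, ((x i).image c).card ≤ ((y i).image c).card :=
      fun i _ => Finset.card_le_card (hsub i)
    rcases (Finset.sum_le_sum hle).lt_or_eq with h | h
    · left
      have := low x hx; have := hcon y hy
      simp only [Fin.mk_lt_mk]
      omega
    · right
      have heq := (Finset.sum_eq_sum_iff_of_le hle).1 h
      have : (fun i => (x i).image c) = fun i => (y i).image c := by
        funext i
        exact Finset.eq_of_subset_of_card_le (hsub i) (heq i (Finset.mem_univ i)).ge
      simp only [this, h]
  · intro ε x hx
    have hnc : ∃ i j, (x i).image c ≠ (x j).image c := by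
      by_contra! h
      obtain ⟨v, hv⟩ := hx.1 0
      obtain ⟨i, hi⟩ := aux_no_common hc hx (c v)
      exact hi (h 0 i ▸ Finset.mem_image_of_mem c hv)
    have h1 := hσ _ hnc ε
    have h2 : ∑ i, ((x (i + ε)).image c).card = ∑ i, ((x i).image c).card :=
      Equiv.sum_comp (Equiv.addRight ε) (fun i => ((x i).image c).card)
    simp only [h2, h1]

theorem aux_sum_le {p : ℕ} [NeZero p] {Ct : Type*} [DecidableEq Ct]
    (A : ZMod p → Finset Ct) (B : Finset Ct) (hAB : ∀ i, A i ⊆ B)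
    (h : ∀ a, ∃ i, a ∉ A i) : ∑ i, (A i).card ≤ (p - 1) * B.card := by
  have : ∀ i, (A i).card = ∑ a ∈ B, if a ∈ A i then 1 else 0 := by
    intro i
    rw [Finset.sum_ite_mem, Finset.inter_eq_right.2 (hAB i)]
    simp
  simp only [this]
  rw [Finset.sum_comm, mul_comm, ← smul_eq_mul]
  apply Finset.sum_le_card_nsmul
  intro a _
  obtain ⟨i, hi⟩ := h a
  rw [← Finset.card_filter]
  have : (Finset.univ.filter fun j => a ∈ A j) ⊆ Finset.univ.erase i := by
    intro j hj
    simp only [Finset.mem_filter, Finset.mem_univ, true_and] at hj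
    simp only [Finset.mem_erase, Finset.mem_univ, and_true]
    rintro rfl
    exact hi hj
  refine (Finset.card_le_card this).trans ?_
  simp [ZMod.card]

theorem aux_nbr {W : Type*} [DecidableEq W] {Eh : Set (Finset W)} {p : ℕ} [NeZero p]
    {U : ZMod p → Finset W} (hU : HomElem Eh p p U) (f : ZMod p → W) (hf : ∀ i, f i ∈ U i)
    (i0 : ZMod p) : ∀ w ∈ U i0, w ∈ closedNbr Eh ((Finset.univ.image f).erase (f i0)) := by
  intro w hw
  have hg : ∀ i, Function.update f i0 w i ∈ U i := by
    intro i
    by_cases h : i = i0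
    · subst h; simpa using hw
    · simpa [h] using hf i
  obtain ⟨he, ginj⟩ := aux_transversal hU _ hg
  obtain ⟨-, finj⟩ := aux_transversal hU f hf
  refine Or.inr ⟨_, he, ?_⟩
  ext v
  simp only [Finset.mem_sdiff, Finset.mem_image, Finset.mem_univ, true_and, Finset.mem_erase,
    Finset.mem_singleton]
  constructor
  · rintro ⟨⟨i, rfl⟩, h⟩
    by_cases hi : i = i0
    · subst hi; simp
    · exact absurd ⟨by simpa [hi] using fun h => hi (finj h), i, by simp [hi]⟩ h
  · rintro rfl
    refine ⟨⟨i0, by simp⟩, ?_⟩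
    rintro ⟨h1, j, hj⟩
    have hji : j = i0 := by
      apply ginj
      by_cases h : j = i0
      · rw [h]
      · simp [h, hj]
    subst hji
    exact h1 hj.symm

/-- **Corollary:** for a `p`-uniform hypergraph `H` with at least one edge (`p` prime)
and `t = Xind_{Z_p}(Hom(K^p_p, H)) + p`, the local chromatic number satisfies
`χ_l(H) ≥ min(⌈t/p⌉ + 1, ⌈t/(p−1)⌉)`: every proper coloring has a pair `(e, v)` whose
closed neighborhood `N[e ∖ {v}]` receives at least that many colors
(`⌈t/p⌉ = (t + p - 1)/p` and `⌈t/(p−1)⌉ = (t + p - 2)/(p - 1)` in ℕ). -/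
theorem local_chromatic_p_uniform {W : Type*} [Fintype W] [DecidableEq W]
    (p : ℕ) (hp : p.Prime)
    (Eh : Set (Finset W)) (hEh : Eh.Nonempty) (hunif : ∀ e ∈ Eh, e.card = p)
    (Ct : Type*) (c : W → Ct)
    (hc : ∀ e ∈ Eh, ∃ u ∈ e, ∃ v ∈ e, c u ≠ c v) :
    ∃ e ∈ Eh, ∃ v ∈ e,
      min ((XindHom Eh p p + p + p - 1) / p + 1)
          ((XindHom Eh p p + p + p - 2) / (p - 1))
        ≤ (c '' closedNbr Eh (e.erase v)).ncard := by
  classical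
  haveI : Fact p.Prime := ⟨hp⟩
  have hp2 := hp.two_le
  obtain ⟨U, hU, ht⟩ := aux_exists (p := p) hEh hunif hc
  generalize XindHom Eh p p = n at ht ⊢
  obtain ⟨i0, -, hmax⟩ := Finset.exists_max_image (Finset.univ : Finset (ZMod p))
    (fun i => ((U i).image c).card) ⟨0, Finset.mem_univ _⟩
  have hfin : ∀ X : Finset W, (c '' closedNbr Eh X).Finite := fun X => Set.toFinite _
  have hnc := aux_no_common hc hU
  choose f hf using hU.1
  by_cases hall : ∀ j, (U j).image c ⊆ (U i0).image c
  · have hs := aux_sum_le (fun i => (U i).image c) _ hall hnc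
    refine ⟨_, (aux_transversal hU f hf).1, f i0,
      Finset.mem_image_of_mem f (Finset.mem_univ _), (min_le_right _ _).trans ?_⟩
    have h1 : ((U i0).image c).card ≤
        (c '' closedNbr Eh ((Finset.univ.image f).erase (f i0))).ncard := by
      rw [← Set.ncard_coe_finset]
      apply Set.ncard_le_ncard _ (hfin _)
      rw [Finset.coe_image]
      exact Set.image_mono (aux_nbr hU f hf i0)
    refine le_trans ?_ h1
    obtain ⟨q, rfl⟩ : ∃ q, p = q + 2 := ⟨p - 2, by omega⟩
    rw [← Nat.lt_succ_iff, Nat.div_lt_iff_lt_mul (by omega)]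
    simp only [Nat.succ_eq_add_one, Nat.add_sub_cancel, show q + 2 - 1 = q + 1 by omega] at hs ⊢
    generalize ((U i0).image c).card = m at hs ⊢
    have : (m + 1) * (q + 1) = (q + 1) * m + (q + 1) := by ring
    omega
  · simp only [not_forall, Finset.not_subset] at hall
    obtain ⟨j, a, ha, ha'⟩ := hall
    obtain ⟨u, hu, rfl⟩ := Finset.mem_image.1 ha
    have hji : j ≠ i0 := by rintro rfl; exact ha' ha
    have hg : ∀ i, Function.update f j u i ∈ U i := by
      intro i
      by_cases h : i = j
      · subst h; simpa using hu
      · simpa [h] using hf i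
    obtain ⟨he, ginj⟩ := aux_transversal hU _ hg
    have hnb := aux_nbr hU _ hg i0
    have huj : Function.update f j u j = u := by simp
    generalize Function.update f j u = g at hg he ginj hnb huj
    refine ⟨_, he, g i0,
      Finset.mem_image_of_mem g (Finset.mem_univ _), (min_le_left _ _).trans ?_⟩
    have h1 : (insert (c u) ((U i0).image c)).card ≤
        (c '' closedNbr Eh ((Finset.univ.image g).erase (g i0))).ncard := by
      rw [← Set.ncard_coe_finset]
      apply Set.ncard_le_ncard _ (hfin _)
      rw [Finset.coe_insert, Finset.coe_image, Set.insert_subset_iff]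
      refine ⟨Set.mem_image_of_mem c (Or.inl ?_), Set.image_mono hnb⟩
      rw [Finset.mem_coe, Finset.mem_erase]
      refine ⟨?_, Finset.mem_image.2 ⟨j, Finset.mem_univ _, huj⟩⟩
      rw [← huj]
      exact fun h => hji (ginj h)
    rw [Finset.card_insert_of_notMem ha'] at h1
    refine le_trans (Nat.add_le_add_right ?_ 1) h1
    have hs := Finset.sum_le_card_nsmul _ _ _ hmax
    rw [Finset.card_univ, ZMod.card, smul_eq_mul] at hs
    rw [← Nat.lt_succ_iff, Nat.div_lt_iff_lt_mul (by omega), Nat.succ_mul, mul_comm]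
    omega
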